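/- Let K ~ Bin(n, q). Then P(K ≤ nq + ln 2) ≥ 1/2. -/

import Mathlib

open MeasureTheory

/-- Coefficients of the odd power series of the comparison function. -/
noncomputable def hamzaE (p c : ℝ) (k : ℕ) : ℝ :=
  (1 - p) * ((c + p) / 2) ^ (2 * k + 1) - p * ((2 - c - p) / 2) ^ (2 * k + 1)
    - ((c - p) / 2) ^ (2 * k + 1)

/-- The comparison function. -/
noncomputable def hamzaF (p c x : ℝ) : ℝ :=
  (1 - p) * Real.sinh ((c + p) / 2 * x) - p * Real.sinh ((2 - c - p) / 2 * x)
    - Real.sinh ((c - p) / 2 * x)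

lemma hamzaF_hasSum (p c x : ℝ) :
    HasSum (fun k : ℕ => hamzaE p c k * (x ^ (2 * k + 1) / ((2 * k + 1).factorial : ℝ)))
      (hamzaF p c x) := by
  have h1 := (Real.hasSum_sinh ((c + p) / 2 * x)).mul_left (1 - p)
  have h2 := (Real.hasSum_sinh ((2 - c - p) / 2 * x)).mul_left p
  have h3 := Real.hasSum_sinh ((c - p) / 2 * x)
  have h := (h1.sub h2).sub h3
  unfold hamzaF
  refine (congrArg (fun f => HasSum f _) (funext fun k => ?_)).mpr h
  simp only [hamzaE, mul_pow]
  ring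

lemma hamzaE_zero (p c : ℝ) : hamzaE p c 0 = 0 := by
  simp only [hamzaE]; ring

lemma hamzaE_one (p c : ℝ) : hamzaE p c 1 = p * (1 - p) * (3 * c - 2 + p) / 2 := by
  simp only [hamzaE]; ring

lemma hamzaE_nonneg_mid (p c : ℝ) (hp : 0 < p) (hp1 : p < 1) (hc1 : c < 1)
    (h1 : 1 - c ≤ p) (h2 : p ≤ c) (k : ℕ) : 0 ≤ hamzaE p c k := by
  induction k with
  | zero => rw [hamzaE_zero]
  | succ k ih =>
    have e : hamzaE p c (k + 1) = ((c + p) / 2) ^ 2 * hamzaE p c k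
        + (p * ((2 - c - p) / 2) ^ (2 * k + 1) * (((c + p) / 2) ^ 2 - ((2 - c - p) / 2) ^ 2)
          + ((c - p) / 2) ^ (2 * k + 1) * (((c + p) / 2) ^ 2 - ((c - p) / 2) ^ 2)) := by
      simp only [hamzaE]; ring
    rw [e]
    have a2 : 0 ≤ (2 - c - p) / 2 := by linarith
    have a3 : 0 ≤ (c - p) / 2 := by linarith
    have d1 : 0 ≤ ((c + p) / 2) ^ 2 - ((2 - c - p) / 2) ^ 2 := by nlinarith
    have d2 : 0 ≤ ((c + p) / 2) ^ 2 - ((c - p) / 2) ^ 2 := by nlinarith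
    positivity

lemma hamzaE_nonneg_big (p c : ℝ) (hp1 : p < 1) (hc : 2 / 3 < c) (hc1 : c < 1)
    (h2 : c < p) (k : ℕ) : 0 ≤ hamzaE p c k := by
  induction k with
  | zero => rw [hamzaE_zero]
  | succ k ih =>
    have e : hamzaE p c (k + 1) = ((2 - c - p) / 2) ^ 2 * hamzaE p c k
        + ((1 - p) * ((c + p) / 2) * (((c + p) / 2) ^ 2 - ((2 - c - p) / 2) ^ 2)
            * (((c + p) / 2) ^ 2) ^ k
          - ((p - c) / 2) * (((2 - c - p) / 2) ^ 2 - ((p - c) / 2) ^ 2)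
            * (((p - c) / 2) ^ 2) ^ k) := by
      have h3 : (c - p) / 2 = - ((p - c) / 2) := by ring
      simp only [hamzaE, h3]
      rw [Odd.neg_pow ⟨k + 1, rfl⟩, Odd.neg_pow ⟨k, rfl⟩]
      simp only [← pow_mul]
      ring
    have e1 : (p - c) / 2 * (((2 - c - p) / 2) ^ 2 - ((p - c) / 2) ^ 2)
        ≤ (1 - p) * ((c + p) / 2) * (((c + p) / 2) ^ 2 - ((2 - c - p) / 2) ^ 2) := by
      have h := hamzaE_one p c
      have h0 : 0 ≤ p * (1 - p) * (3 * c - 2 + p) / 2 := by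
        have : 0 ≤ 1 - p := by linarith
        have : 0 ≤ 3 * c - 2 + p := by linarith
        have : 0 ≤ p := by linarith
        positivity
      nlinarith
    have d2 : 0 ≤ ((2 - c - p) / 2) ^ 2 - ((p - c) / 2) ^ 2 := by nlinarith
    have d3 : ((p - c) / 2) ^ 2 ≤ ((c + p) / 2) ^ 2 := by nlinarith
    have b0 : 0 ≤ (p - c) / 2 := by linarith
    have d4 : (((p - c) / 2) ^ 2) ^ k ≤ (((c + p) / 2) ^ 2) ^ k :=
      pow_le_pow_left₀ (by positivity) d3 k
    have d5 := mul_le_mul e1 d4 (by positivity) (le_trans (by positivity) e1)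
    rw [e]
    have : 0 ≤ ((2 - c - p) / 2) ^ 2 * hamzaE p c k := by positivity
    linarith

lemma hamzaE_small (p c : ℝ) (hp : 0 < p) (hc : 2 / 3 < c)
    (h1 : p < 1 - c) (k : ℕ) (hk : hamzaE p c k < 0) : hamzaE p c (k + 1) < 0 := by
  let h : ℕ → ℝ := fun k => ((c - p) / 2) ^ (2 * k + 1) * (((c + p) / 2) ^ 2 - ((c - p) / 2) ^ 2)
    - p * ((2 - c - p) / 2) ^ (2 * k + 1) * (((2 - c - p) / 2) ^ 2 - ((c + p) / 2) ^ 2)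
  have e : ∀ k, hamzaE p c (k + 1) = ((c + p) / 2) ^ 2 * hamzaE p c k + h k := by
    intro k; simp only [hamzaE, h]; ring
  have a3 : 0 < (c - p) / 2 := by linarith
  have a2 : 0 < (2 - c - p) / 2 := by linarith
  have d1 : 0 < ((2 - c - p) / 2) ^ 2 - ((c + p) / 2) ^ 2 := by nlinarith
  have d2 : 0 < ((2 - c - p) / 2) ^ 2 - ((c - p) / 2) ^ 2 := by nlinarith
  have hs : ∀ k, h k < 0 → h (k + 1) < 0 := by
    intro k hk
    have e : h (k + 1) = ((c - p) / 2) ^ 2 * h k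
      - p * ((2 - c - p) / 2) ^ (2 * k + 1) * (((2 - c - p) / 2) ^ 2 - ((c + p) / 2) ^ 2)
        * (((2 - c - p) / 2) ^ 2 - ((c - p) / 2) ^ 2) := by
      simp only [h]; ring
    rw [e]
    have : 0 < p * ((2 - c - p) / 2) ^ (2 * k + 1) * (((2 - c - p) / 2) ^ 2 - ((c + p) / 2) ^ 2)
        * (((2 - c - p) / 2) ^ 2 - ((c - p) / 2) ^ 2) := by positivity
    have : ((c - p) / 2) ^ 2 * h k < 0 := mul_neg_of_pos_of_neg (by positivity) hk
    linarith
  have a1 : 0 < ((c + p) / 2) ^ 2 := by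
    have : 0 < (c + p) / 2 := by linarith
    positivity
  have key : ∀ k, hamzaE p c k < 0 → h k < 0 := by
    intro k
    induction k with
    | zero => intro hk; rw [hamzaE_zero] at hk; exact absurd hk (lt_irrefl _)
    | succ k ih =>
      intro hk
      by_contra hh
      have h3 : 0 ≤ h k := by
        by_contra h4
        exact hh (hs k (not_le.mp h4))
      rw [e k] at hk
      have h5 : hamzaE p c k < 0 := by
        by_contra h6
        have := mul_nonneg a1.le (not_lt.mp h6)
        linarith
      linarith [ih h5]
  rw [e k]
  have := mul_neg_of_pos_of_neg a1 hk
  linarith [key k hk]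

lemma hamzaF_crossing (p c : ℝ) (hp : 0 < p) (hp1 : p < 1) (hc : 2 / 3 < c) (hc1 : c < 1) :
    (∀ x, 0 < x → 0 ≤ hamzaF p c x) ∨
    (∀ x y, 0 < x → x ≤ y → hamzaF p c x ≤ 0 → hamzaF p c y ≤ 0) := by
  by_cases hE : ∀ k, 0 ≤ hamzaE p c k
  · left
    intro x hx
    refine (hamzaF_hasSum p c x).nonneg fun k => ?_
    have := hE k
    positivity
  · right
    have hsmall : p < 1 - c := by
      by_contra h
      apply hE
      rcases le_or_gt p c with h2 | h2
      · exact hamzaE_nonneg_mid p c hp hp1 hc1 (not_lt.mp h) h2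
      · exact hamzaE_nonneg_big p c hp1 hc hc1 h2
    have hE' : ∃ k, hamzaE p c k < 0 := by
      by_contra h; push Not at h; exact hE h
    classical
    obtain ⟨K, hK, hmin⟩ : ∃ K, hamzaE p c K < 0 ∧ ∀ k, k < K → 0 ≤ hamzaE p c k :=
      ⟨Nat.find hE', Nat.find_spec hE', fun k hk => not_lt.mp (Nat.find_min hE' hk)⟩
    have hge : ∀ k, K ≤ k → hamzaE p c k < 0 := by
      intro k hk
      induction k, hk using Nat.le_induction with
      | base => exact hK
      | succ k _ ih => exact hamzaE_small p c hp hc hsmall k ih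
    intro x y hx hxy hF
    have hy : 0 < y := lt_of_lt_of_le hx hxy
    have hle : x ^ (2 * K + 1) * hamzaF p c y ≤ y ^ (2 * K + 1) * hamzaF p c x := by
      refine hasSum_le (fun k => ?_) ((hamzaF_hasSum p c y).mul_left (x ^ (2 * K + 1)))
        ((hamzaF_hasSum p c x).mul_left (y ^ (2 * K + 1)))
      have hf : (0:ℝ) < ((2 * k + 1).factorial : ℝ) := by positivity
      have e1 : x ^ (2 * K + 1) * (hamzaE p c k * (y ^ (2 * k + 1) / ((2 * k + 1).factorial : ℝ)))
        = (hamzaE p c k * (x ^ (2 * K + 1) * y ^ (2 * k + 1))) / ((2 * k + 1).factorial : ℝ) := by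
        ring
      have e2 : y ^ (2 * K + 1) * (hamzaE p c k * (x ^ (2 * k + 1) / ((2 * k + 1).factorial : ℝ)))
        = (hamzaE p c k * (y ^ (2 * K + 1) * x ^ (2 * k + 1))) / ((2 * k + 1).factorial : ℝ) := by
        ring
      rw [e1, e2]
      apply div_le_div_of_nonneg_right _ hf.le
      rcases lt_or_ge k K with h | h
      · apply mul_le_mul_of_nonneg_left _ (hmin k h)
        obtain ⟨d, rfl⟩ := Nat.exists_eq_add_of_lt h
        have e3 : x ^ (2 * (k + d + 1) + 1) * y ^ (2 * k + 1)
          = x ^ (2 * d + 2) * (x ^ (2 * k + 1) * y ^ (2 * k + 1)) := by ring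
        have e4 : y ^ (2 * (k + d + 1) + 1) * x ^ (2 * k + 1)
          = y ^ (2 * d + 2) * (x ^ (2 * k + 1) * y ^ (2 * k + 1)) := by ring
        rw [e3, e4]
        gcongr
      · apply mul_le_mul_of_nonpos_left _ (hge k h).le
        obtain ⟨d, rfl⟩ := Nat.exists_eq_add_of_le h
        have e3 : x ^ (2 * K + 1) * y ^ (2 * (K + d) + 1)
          = y ^ (2 * d) * (x ^ (2 * K + 1) * y ^ (2 * K + 1)) := by ring
        have e4 : y ^ (2 * K + 1) * x ^ (2 * (K + d) + 1)
          = x ^ (2 * d) * (x ^ (2 * K + 1) * y ^ (2 * K + 1)) := by ring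
        rw [e3, e4]
        gcongr
    have h1 : y ^ (2 * K + 1) * hamzaF p c x ≤ 0 :=
      mul_nonpos_of_nonneg_of_nonpos (by positivity) hF
    by_contra h2
    have : 0 < x ^ (2 * K + 1) * hamzaF p c y := mul_pos (by positivity) (not_le.mp h2)
    linarith

/-- Upper point of the matched pair. -/
noncomputable def hamzaT (p x : ℝ) : ℝ := (Real.exp x - Real.exp ((1 - p) * x)) / (Real.exp x - 1)

/-- Lower point of the matched pair. -/
noncomputable def hamzaS (p x : ℝ) : ℝ := (Real.exp (p * x) - 1) / (Real.exp x - 1)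

lemma hamza_exp_mul (p x : ℝ) : Real.exp ((1 - p) * x) * Real.exp (p * x) = Real.exp x := by
  rw [← Real.exp_add]; congr 1; ring

lemma hamza_E_pos {x : ℝ} (hx : 0 < x) : 0 < Real.exp x - 1 := by
  have := Real.add_one_lt_exp hx.ne'
  linarith

lemma hamza_convex (p x : ℝ) (hp : 0 < p) (hp1 : p < 1) :
    Real.exp (p * x) ≤ p * Real.exp x + (1 - p) := by
  have h := convexOn_exp.2 (Set.mem_univ x) (Set.mem_univ (0:ℝ)) hp.le
    (by linarith : (0:ℝ) ≤ 1 - p) (by ring)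
  simpa using h

lemma hamzaT_eq (p x : ℝ) : hamzaT p x = Real.exp ((1 - p) * x) * hamzaS p x := by
  unfold hamzaT hamzaS
  rw [← hamza_exp_mul p x]; ring

lemma hamza_one_sub_T (p : ℝ) {x : ℝ} (hx : 0 < x) :
    1 - hamzaT p x = (Real.exp ((1 - p) * x) - 1) / (Real.exp x - 1) := by
  have := (hamza_E_pos hx).ne'
  unfold hamzaT
  field_simp
  ring

lemma hamza_one_sub_S (p : ℝ) {x : ℝ} (hx : 0 < x) :
    1 - hamzaS p x = Real.exp (p * x) * (1 - hamzaT p x) := by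
  rw [hamza_one_sub_T p hx]
  have := (hamza_E_pos hx).ne'
  unfold hamzaS
  have h := hamza_exp_mul p x
  generalize Real.exp ((1 - p) * x) = A at *
  field_simp
  linear_combination - h

lemma hamzaS_pos (p : ℝ) (hp : 0 < p) {x : ℝ} (hx : 0 < x) : 0 < hamzaS p x :=
  div_pos (hamza_E_pos (mul_pos hp hx)) (hamza_E_pos hx)

lemma hamza_one_sub_T_pos (p : ℝ) (hp1 : p < 1) {x : ℝ} (hx : 0 < x) : 0 < 1 - hamzaT p x := by
  rw [hamza_one_sub_T p hx]
  exact div_pos (hamza_E_pos (mul_pos (by linarith) hx)) (hamza_E_pos hx)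

lemma hamzaT_sub (p : ℝ) {x : ℝ} (hx : 0 < x) : hamzaT p x - p =
    ((1 - p) * Real.exp x - Real.exp ((1 - p) * x) + p) / (Real.exp x - 1) := by
  have := (hamza_E_pos hx).ne'
  unfold hamzaT
  field_simp
  ring

lemma hamzaS_sub (p : ℝ) {x : ℝ} (hx : 0 < x) : p - hamzaS p x =
    (p * Real.exp x - Real.exp (p * x) + (1 - p)) / (Real.exp x - 1) := by
  have := (hamza_E_pos hx).ne'
  unfold hamzaS
  field_simp
  ring

lemma hamzaT_ge (p : ℝ) (hp : 0 < p) (hp1 : p < 1) {x : ℝ} (hx : 0 < x) : p ≤ hamzaT p x := by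
  have h := hamzaT_sub p hx
  have h1 := hamza_convex (1 - p) x (by linarith) (by linarith)
  have : 0 ≤ hamzaT p x - p := by
    rw [h]; exact div_nonneg (by linarith) (hamza_E_pos hx).le
  linarith

lemma hamzaS_le (p : ℝ) (hp : 0 < p) (hp1 : p < 1) {x : ℝ} (hx : 0 < x) : hamzaS p x ≤ p := by
  have h := hamzaS_sub p hx
  have h1 := hamza_convex p x hp hp1
  have : 0 ≤ p - hamzaS p x := by
    rw [h]; exact div_nonneg (by linarith) (hamza_E_pos hx).le
  linarith

lemma hamzaT_deriv (p : ℝ) {x : ℝ} (hx : 0 < x) :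
    HasDerivAt (hamzaT p) (Real.exp ((1 - p) * x) * (p - hamzaS p x) / (Real.exp x - 1)) x := by
  have hE := (hamza_E_pos hx).ne'
  have h1 : HasDerivAt (fun x : ℝ => Real.exp ((1 - p) * x))
      (Real.exp ((1 - p) * x) * ((1 - p) * 1)) x := ((hasDerivAt_id x).const_mul (1 - p)).exp
  have h2 := ((Real.hasDerivAt_exp x).sub h1).div ((Real.hasDerivAt_exp x).sub_const 1) hE
  have h := hamza_exp_mul p x
  refine HasDerivAt.congr_deriv h2 ?_
  rw [hamzaS_sub p hx]
  field_simp
  simp only [Pi.sub_apply]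
  linear_combination h

lemma hamzaS_deriv (p : ℝ) {x : ℝ} (hx : 0 < x) :
    HasDerivAt (hamzaS p) (-(Real.exp (p * x) * (hamzaT p x - p) / (Real.exp x - 1))) x := by
  have hE := (hamza_E_pos hx).ne'
  have h1 : HasDerivAt (fun x : ℝ => Real.exp (p * x))
      (Real.exp (p * x) * (p * 1)) x := ((hasDerivAt_id x).const_mul p).exp
  have h2 := (h1.sub_const 1).div ((Real.hasDerivAt_exp x).sub_const 1) hE
  have h := hamza_exp_mul p x
  refine HasDerivAt.congr_deriv h2 ?_
  rw [hamzaT_sub p hx]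
  generalize Real.exp ((1 - p) * x) = A at *
  field_simp
  linear_combination - h

lemma hamzaT_mono (p : ℝ) (hp : 0 < p) (hp1 : p < 1) : MonotoneOn (hamzaT p) (Set.Ioi 0) := by
  apply monotoneOn_of_deriv_nonneg (convex_Ioi 0)
  · intro x hx
    exact (hamzaT_deriv p hx).continuousAt.continuousWithinAt
  · intro x hx
    rw [interior_Ioi] at hx
    exact (hamzaT_deriv p hx).differentiableAt.differentiableWithinAt
  · intro x hx
    rw [interior_Ioi] at hx
    rw [(hamzaT_deriv p hx).deriv]
    have := hamzaS_le p hp hp1 hx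
    have := hamza_E_pos hx
    apply div_nonneg (mul_nonneg (Real.exp_pos _).le (by linarith)) this.le

open Filter Topology in
lemma hamzaT_tendsto_zero (p : ℝ) : Tendsto (hamzaT p) (𝓝[>] 0) (𝓝 p) := by
  have h1 : HasDerivAt (fun x : ℝ => Real.exp x - Real.exp ((1 - p) * x)) p 0 := by
    have h1 : HasDerivAt (fun x : ℝ => Real.exp ((1 - p) * x))
      (Real.exp ((1 - p) * 0) * ((1 - p) * 1)) 0 := ((hasDerivAt_id (0:ℝ)).const_mul (1 - p)).exp
    refine HasDerivAt.congr_deriv ((Real.hasDerivAt_exp 0).sub h1) ?_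
    simp
  have h2 : HasDerivAt (fun x : ℝ => Real.exp x - 1) 1 0 := by
    simpa using (Real.hasDerivAt_exp 0).sub_const 1
  rw [hasDerivAt_iff_tendsto_slope_zero] at h1 h2
  have h3 := (h1.div h2 one_ne_zero).mono_left
    (nhdsWithin_mono 0 (fun x (hx : 0 < x) => hx.ne'))
  rw [div_one] at h3
  refine h3.congr' ?_
  filter_upwards [self_mem_nhdsWithin] with x hx
  have hx : x ≠ 0 := ne_of_gt hx
  simp only [hamzaT, zero_add, smul_eq_mul, mul_zero, Real.exp_zero, sub_self, sub_zero, Pi.div_apply]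
  field_simp

lemma hamzaS_eq (p x : ℝ) : hamzaS p x = Real.exp (-((1 - p) * x)) * hamzaT p x := by
  rw [hamzaT_eq, ← mul_assoc, ← Real.exp_add]; simp

open Filter Topology in
lemma hamzaS_tendsto_zero (p : ℝ) : Tendsto (hamzaS p) (𝓝[>] 0) (𝓝 p) := by
  have h : Tendsto (fun x : ℝ => Real.exp (-((1 - p) * x))) (𝓝[>] 0) (𝓝 1) := by
    have : Continuous (fun x : ℝ => Real.exp (-((1 - p) * x))) := by fun_prop
    have h := this.tendsto 0
    simp only [mul_zero, neg_zero, Real.exp_zero] at h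
    exact h.mono_left nhdsWithin_le_nhds
  have h2 := h.mul (hamzaT_tendsto_zero p)
  rw [one_mul] at h2
  exact h2.congr fun x => (hamzaS_eq p x).symm

open Filter Topology in
lemma hamza_exp_tendsto (q : ℝ) (hq : 0 < q) :
    Tendsto (fun x : ℝ => Real.exp (-(q * x))) atTop (𝓝 0) :=
  Real.tendsto_exp_neg_atTop_nhds_zero.comp (tendsto_id.const_mul_atTop hq)

open Filter Topology in
lemma hamzaT_tendsto_top (p : ℝ) (hp : 0 < p) : Tendsto (hamzaT p) atTop (𝓝 1) := by
  have h1 := (hamza_exp_tendsto p hp).const_sub 1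
  have h2 := (hamza_exp_tendsto 1 one_pos).const_sub 1
  have h3 := h1.div h2 (by norm_num)
  simp only [sub_zero, div_one] at h3
  refine h3.congr' ?_
  filter_upwards [eventually_gt_atTop 0] with x hx
  have hE := (hamza_E_pos hx).ne'
  have hx1 := (Real.exp_pos x).ne'
  have hx2 := (Real.exp_pos (p * x)).ne'
  have h := hamza_exp_mul p x
  simp only [hamzaT, Pi.div_apply, one_mul, Real.exp_neg]
  have : 1 - (Real.exp x)⁻¹ = (Real.exp x - 1) / Real.exp x := by field_simp
  rw [this]
  generalize Real.exp ((1 - p) * x) = A at *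
  field_simp
  linear_combination h

open Filter Topology in
lemma hamzaS_tendsto_top (p : ℝ) (hp : 0 < p) (hp1 : p < 1) :
    Tendsto (hamzaS p) atTop (𝓝 0) := by
  have h2 := (hamza_exp_tendsto (1 - p) (by linarith)).mul (hamzaT_tendsto_top p hp)
  rw [zero_mul] at h2
  exact h2.congr fun x => (hamzaS_eq p x).symm

lemma hamza_bracket (p c : ℝ) {x : ℝ} (hx : 0 < x) :
    Real.exp (c * x) * (hamzaT p x - p) - Real.exp ((1 - p) * x) * (p - hamzaS p x)
      = 2 * Real.exp ((1 - p) * x + (c + p) / 2 * x) / (Real.exp x - 1) * hamzaF p c x := by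
  rw [hamzaT_sub p hx, hamzaS_sub p hx]
  have hE := (hamza_E_pos hx).ne'
  set M := Real.exp ((1 - p) * x + (c + p) / 2 * x) with hM
  have k1 : M * Real.exp ((c + p) / 2 * x) = Real.exp (c * x) * Real.exp x := by
    rw [hM, ← Real.exp_add, ← Real.exp_add]; congr 1; ring
  have k2 : M * Real.exp (-((c + p) / 2 * x)) = Real.exp ((1 - p) * x) := by
    rw [hM, ← Real.exp_add]; congr 1; ring
  have k3 : M * Real.exp ((2 - c - p) / 2 * x) = Real.exp ((1 - p) * x) * Real.exp x := by
    rw [hM, ← Real.exp_add, ← Real.exp_add]; congr 1; ring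
  have k4 : M * Real.exp (-((2 - c - p) / 2 * x)) = Real.exp (c * x) := by
    rw [hM, ← Real.exp_add]; congr 1; ring
  have k5 : M * Real.exp ((c - p) / 2 * x) = Real.exp (c * x) * Real.exp ((1 - p) * x) := by
    rw [hM, ← Real.exp_add, ← Real.exp_add]; congr 1; ring
  have k6 : M * Real.exp (-((c - p) / 2 * x)) = Real.exp ((1 - p) * x) * Real.exp (p * x) := by
    rw [hM, ← Real.exp_add, ← Real.exp_add]; congr 1; ring
  simp only [hamzaF, Real.sinh_eq]
  clear_value M
  clear hM
  generalize Real.exp ((1 - p) * x) = A at *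
  generalize Real.exp (p * x) = B at *
  generalize Real.exp (c * x) = G at *
  generalize Real.exp ((c + p) / 2 * x) = A1 at *
  generalize Real.exp (-((c + p) / 2 * x)) = A2 at *
  generalize Real.exp ((2 - c - p) / 2 * x) = A3 at *
  generalize Real.exp (-((2 - c - p) / 2 * x)) = A4 at *
  generalize Real.exp ((c - p) / 2 * x) = A5 at *
  generalize Real.exp (-((c - p) / 2 * x)) = A6 at *
  field_simp
  linear_combination (-(1 - p)) * k1 + (1 - p) * k2 + p * k3 - p * k4 + k5 - k6

lemma hamza_wt_anti (p a s : ℝ) (hp : 0 < p) (ha : 0 ≤ a) (hs : s * p = (1 - p) * a)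
    (y z : ℝ) (hy : p ≤ y) (hyz : y ≤ z) (hz : z < 1) :
    z ^ a * (1 - z) ^ s ≤ y ^ a * (1 - y) ^ s := by
  have hy0 : 0 < y := by linarith
  have hz0 : 0 < z := by linarith
  have hy1 : 0 < 1 - y := by linarith
  have hz1 : 0 < 1 - z := by linarith
  have hs0 : 0 ≤ s := by
    have : s = (1 - p) * a / p := by field_simp; linarith
    rw [this]
    have : 0 ≤ 1 - p := by linarith
    positivity
  rw [Real.rpow_def_of_pos hy0, Real.rpow_def_of_pos hz0, Real.rpow_def_of_pos hy1,
    Real.rpow_def_of_pos hz1, ← Real.exp_add, ← Real.exp_add, Real.exp_le_exp]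
  have l1 : Real.log z - Real.log y ≤ (z - y) / y := by
    rw [← Real.log_div hz0.ne' hy0.ne']
    have := Real.log_le_sub_one_of_pos (div_pos hz0 hy0)
    have e : z / y - 1 = (z - y) / y := by field_simp
    linarith
  have l2 : Real.log (1 - z) - Real.log (1 - y) ≤ -((z - y) / (1 - y)) := by
    rw [← Real.log_div hz1.ne' hy1.ne']
    have := Real.log_le_sub_one_of_pos (div_pos hz1 hy1)
    have e : (1 - z) / (1 - y) - 1 = -((z - y) / (1 - y)) := by field_simp; ring
    linarith
  have l3 : a * ((z - y) / y) ≤ s * ((z - y) / (1 - y)) := by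
    have h1 : a * (1 - y) ≤ s * y := by
      have : p * (a * (1 - y)) ≤ p * (s * y) := by
        have : p * (s * y) = (1 - p) * a * y := by rw [← hs]; ring
        rw [this]
        have := mul_le_mul_of_nonneg_left hy ha
        nlinarith
      exact le_of_mul_le_mul_left this hp
    have h2 := mul_le_mul_of_nonneg_right h1 (by linarith : 0 ≤ z - y)
    rw [← mul_div_assoc, ← mul_div_assoc, div_le_div_iff₀ hy0 hy1]
    nlinarith
  have m1 := mul_le_mul_of_nonneg_left l1 ha
  have m2 := mul_le_mul_of_nonneg_left l2 hs0
  nlinarith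

lemma hamza_weight (p c a s : ℝ) (hp : 0 < p) (hp1 : p < 1) (hc : 2 / 3 < c) (hc1 : c < 1)
    (ha : 0 ≤ a) (hs : s * p = (1 - p) * a) :
    ∃ w : ℝ, 0 ≤ w ∧ ∀ x, 0 < x →
      0 ≤ (hamzaT p x ^ a * (1 - hamzaT p x) ^ s - w) * hamzaF p c x := by
  have hpos : ∀ x, 0 < x → 0 ≤ hamzaT p x ^ a * (1 - hamzaT p x) ^ s := by
    intro x hx
    have h1 := hamzaT_ge p hp hp1 hx
    have h2 := hamza_one_sub_T_pos p hp1 hx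
    have h3 : 0 ≤ hamzaT p x := by linarith
    positivity
  rcases hamzaF_crossing p c hp hp1 hc hc1 with h | h
  · refine ⟨0, le_rfl, fun x hx => ?_⟩
    rw [sub_zero]
    exact mul_nonneg (hpos x hx) (h x hx)
  · let W : Set ℝ := (fun x => hamzaT p x ^ a * (1 - hamzaT p x) ^ s) ''
      {x | 0 < x ∧ hamzaF p c x ≤ 0}
    have hanti : ∀ x y, 0 < x → x ≤ y → hamzaT p y ^ a * (1 - hamzaT p y) ^ s
        ≤ hamzaT p x ^ a * (1 - hamzaT p x) ^ s := by
      intro x y hx hxy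
      have hy := lt_of_lt_of_le hx hxy
      have := hamza_one_sub_T_pos p hp1 hy
      exact hamza_wt_anti p a s hp ha hs _ _ (hamzaT_ge p hp hp1 hx)
        (hamzaT_mono p hp hp1 hx hy hxy) (by linarith)
    have hbdd : BddAbove W := by
      refine ⟨p ^ a * (1 - p) ^ s, ?_⟩
      rintro _ ⟨x, ⟨hx, _⟩, rfl⟩
      have := hamza_one_sub_T_pos p hp1 hx
      exact hamza_wt_anti p a s hp ha hs _ _ le_rfl (hamzaT_ge p hp hp1 hx) (by linarith)
    have hW0 : 0 ≤ sSup W := by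
      apply Real.sSup_nonneg
      rintro _ ⟨x, ⟨hx, _⟩, rfl⟩
      exact hpos x hx
    refine ⟨sSup W, hW0, fun x hx => ?_⟩
    rcases le_or_gt (hamzaF p c x) 0 with hF | hF
    · apply mul_nonneg_of_nonpos_of_nonpos _ hF
      have : hamzaT p x ^ a * (1 - hamzaT p x) ^ s ≤ sSup W := le_csSup hbdd ⟨x, ⟨hx, hF⟩, rfl⟩
      linarith
    · apply mul_nonneg _ hF.le
      have : sSup W ≤ hamzaT p x ^ a * (1 - hamzaT p x) ^ s := by
        apply Real.sSup_le _ (hpos x hx)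
        rintro _ ⟨y, ⟨hy, hFy⟩, rfl⟩
        have hxy : x ≤ y := by
          by_contra hlt
          have := h y x hy (not_le.mp hlt).le hFy
          linarith
        exact hanti x y hx hxy
      linarith

open Filter Topology in
lemma hamza_core (a b : ℕ) (c p C : ℝ) (hc : 2 / 3 < c) (hc1 : c < 1)
    (hexp : Real.exp (-c) ≤ 1 / 2) (hp : 0 < p) (hp1 : p < 1) (hC : 0 < C)
    (hpe : p * (a + b + 1) = a + c) (Φ : ℝ → ℝ)
    (hΦ : ∀ y, HasDerivAt Φ (-(C * (y ^ a * (1 - y) ^ b))) y) (h0 : Φ 0 = 1) (h1 : Φ 1 = 0) :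
    Φ p ≤ 1 / 2 := by
  obtain ⟨s, hs⟩ : ∃ s : ℝ, s * p = (1 - p) * a := ⟨(1 - p) * a / p, by field_simp⟩
  obtain ⟨N, hN⟩ : ∃ N : ℝ, N * p = c := ⟨c / p, by field_simp⟩
  have hN0 : 0 < N := by
    by_contra h
    have := mul_nonpos_of_nonpos_of_nonneg (not_lt.mp h) hp.le
    linarith
  have hb : (b : ℝ) = s + (N - 1) := by
    have : (b : ℝ) * p = (s + (N - 1)) * p := by linear_combination hpe - hs - hN
    exact mul_right_cancel₀ hp.ne' this
  obtain ⟨w, hw0, hw⟩ := hamza_weight p c a s hp hp1 hc hc1 (by positivity) hs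
  let k : ℝ := C * w / N
  have hk : 0 ≤ k := by positivity
  let Ξ : ℝ → ℝ := fun y => Φ y - k * (1 - y) ^ N
  let Ξ' : ℝ → ℝ := fun y => -(C * (y ^ a * (1 - y) ^ b)) + C * w * (1 - y) ^ (N - 1)
  have hΞ : ∀ y, y < 1 → HasDerivAt Ξ (Ξ' y) y := by
    intro y hy
    have h2 : HasDerivAt (fun y : ℝ => 1 - y) (-1) y := by
      simpa using (hasDerivAt_id y).const_sub 1
    have h3 := (h2.rpow_const (p := N) (Or.inl (by linarith : (1 - y) ≠ 0))).const_mul k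
    refine ((hΦ y).sub h3).congr_deriv ?_
    simp only [Ξ', k]
    field_simp
    ring
  have hcont : Continuous Ξ := by
    have hc1 : Continuous Φ := continuous_iff_continuousAt.mpr fun y => (hΦ y).continuousAt
    have hc2 : Continuous (fun y : ℝ => (1 - y) ^ N) :=
      (continuous_const.sub continuous_id).rpow_const (fun y => Or.inr hN0.le)
    exact hc1.sub (continuous_const.mul hc2)
  let M : ℝ → ℝ := fun x => Ξ p + Ξ p - Ξ (hamzaT p x) - Ξ (hamzaS p x)
  have hM : ∀ x, 0 < x → ∃ m, m ≤ 0 ∧ HasDerivAt M m x := by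
    intro x hx
    have hT1 := hamza_one_sub_T_pos p hp1 hx
    have hTp := hamzaT_ge p hp hp1 hx
    have hSp := hamzaS_le p hp hp1 hx
    have hS0 := hamzaS_pos p hp hx
    have hE := hamza_E_pos hx
    have d1 : HasDerivAt (fun x => Ξ (hamzaT p x)) _ x :=
      (hΞ (hamzaT p x) (by linarith)).comp x (hamzaT_deriv p hx)
    have d2 : HasDerivAt (fun x => Ξ (hamzaS p x)) _ x :=
      (hΞ (hamzaS p x) (by linarith)).comp x (hamzaS_deriv p hx)
    refine ⟨_, ?_, (d1.const_sub (Ξ p + Ξ p)).sub d2⟩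
    have hST : Ξ' (hamzaS p x) * Real.exp (p * x) = Real.exp (c * x) * Ξ' (hamzaT p x) := by
      have e1 : hamzaS p x ^ a * (1 - hamzaS p x) ^ b * Real.exp (p * x)
          = Real.exp (c * x) * (hamzaT p x ^ a * (1 - hamzaT p x) ^ b) := by
        rw [hamza_one_sub_S p hx, hamzaS_eq, mul_pow, mul_pow, ← Real.exp_nat_mul,
          ← Real.exp_nat_mul]
        have : Real.exp (c * x) = Real.exp (a * -((1 - p) * x)) * Real.exp (b * (p * x))
            * Real.exp (p * x) := by
          rw [← Real.exp_add, ← Real.exp_add]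
          congr 1
          linear_combination (-x) * hpe
        rw [this]; ring
      have e2 : (1 - hamzaS p x) ^ (N - 1) * Real.exp (p * x)
          = Real.exp (c * x) * (1 - hamzaT p x) ^ (N - 1) := by
        rw [hamza_one_sub_S p hx, Real.mul_rpow (Real.exp_pos _).le hT1.le, ← Real.exp_mul]
        have : Real.exp (c * x) = Real.exp (p * x * (N - 1)) * Real.exp (p * x) := by
          rw [← Real.exp_add]
          congr 1
          linear_combination (-x) * hN
        rw [this]; ring
      simp only [Ξ']
      linear_combination (-C) * e1 + C * w * e2
    have hT : Ξ' (hamzaT p x) = -(C * (1 - hamzaT p x) ^ (N - 1)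
        * (hamzaT p x ^ (a:ℝ) * (1 - hamzaT p x) ^ s - w)) := by
      have : (1 - hamzaT p x) ^ b = (1 - hamzaT p x) ^ s * (1 - hamzaT p x) ^ (N - 1) := by
        rw [← Real.rpow_add hT1, ← hb, Real.rpow_natCast]
      simp only [Ξ', this, Real.rpow_natCast]
      ring
    have hbr := hamza_bracket p c hx
    have hfin := hw x hx
    have e : -(Ξ' (hamzaT p x) * (Real.exp ((1 - p) * x) * (p - hamzaS p x) / (Real.exp x - 1)))
        - Ξ' (hamzaS p x) * -(Real.exp (p * x) * (hamzaT p x - p) / (Real.exp x - 1))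
        = -((C * (1 - hamzaT p x) ^ (N - 1) / (Real.exp x - 1))
          * (2 * Real.exp ((1 - p) * x + (c + p) / 2 * x) / (Real.exp x - 1))
          * ((hamzaT p x ^ (a:ℝ) * (1 - hamzaT p x) ^ s - w) * hamzaF p c x)) := by
      have e3 : -(Ξ' (hamzaT p x) * (Real.exp ((1 - p) * x) * (p - hamzaS p x) / (Real.exp x - 1)))
        - Ξ' (hamzaS p x) * -(Real.exp (p * x) * (hamzaT p x - p) / (Real.exp x - 1))
        = Ξ' (hamzaT p x) * (Real.exp (c * x) * (hamzaT p x - p)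
            - Real.exp ((1 - p) * x) * (p - hamzaS p x)) / (Real.exp x - 1) := by
        linear_combination ((hamzaT p x - p) / (Real.exp x - 1)) * hST
      rw [e3, hbr, hT]
      ring
    rw [e]
    have : 0 ≤ (C * (1 - hamzaT p x) ^ (N - 1) / (Real.exp x - 1))
          * (2 * Real.exp ((1 - p) * x + (c + p) / 2 * x) / (Real.exp x - 1)) := by positivity
    exact neg_nonpos.mpr (mul_nonneg this hfin)
  have hanti : AntitoneOn M (Set.Ioi 0) := by
    apply antitoneOn_of_deriv_nonpos (convex_Ioi 0)
    · intro x hx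
      obtain ⟨m, _, hd⟩ := hM x hx
      exact hd.continuousAt.continuousWithinAt
    · intro x hx
      rw [interior_Ioi] at hx
      obtain ⟨m, _, hd⟩ := hM x hx
      exact hd.differentiableAt.differentiableWithinAt
    · intro x hx
      rw [interior_Ioi] at hx
      obtain ⟨m, hm, hd⟩ := hM x hx
      rw [hd.deriv]; exact hm
  have lim0 : Tendsto M (𝓝[>] 0) (𝓝 0) := by
    have t1 := (hcont.tendsto p).comp (hamzaT_tendsto_zero p)
    have t2 := (hcont.tendsto p).comp (hamzaS_tendsto_zero p)
    have := (t1.const_sub (Ξ p + Ξ p)).sub t2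
    have e : Ξ p + Ξ p - Ξ p - Ξ p = 0 := by ring
    rw [e] at this
    exact this
  have limtop : Tendsto M atTop (𝓝 (Ξ p + Ξ p - Ξ 1 - Ξ 0)) := by
    have t1 := (hcont.tendsto 1).comp (hamzaT_tendsto_top p hp)
    have t2 := (hcont.tendsto 0).comp (hamzaS_tendsto_top p hp hp1)
    exact (t1.const_sub (Ξ p + Ξ p)).sub t2
  have hM0 : ∀ x, 0 < x → M x ≤ 0 := by
    intro x hx
    refine ge_of_tendsto lim0 ?_
    filter_upwards [Ioo_mem_nhdsGT hx] with y hy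
    exact hanti hy.1 hx hy.2.le
  have hfin : Ξ p + Ξ p - Ξ 1 - Ξ 0 ≤ 0 := by
    refine le_of_tendsto limtop ?_
    filter_upwards [eventually_gt_atTop 0] with x hx
    exact hM0 x hx
  have hbase : (1 - p) ^ N ≤ 1 / 2 := by
    have h2 : (1 - p) ^ N ≤ (Real.exp (-p)) ^ N :=
      Real.rpow_le_rpow (by linarith) (Real.one_sub_le_exp_neg p) hN0.le
    rw [← Real.exp_mul] at h2
    have : -p * N = -c := by linear_combination -hN
    rw [this] at h2
    linarith
  simp only [Ξ, h0, h1, sub_self, sub_zero, Real.zero_rpow hN0.ne', Real.one_rpow] at hfin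
  have := mul_le_mul_of_nonneg_left hbase hk
  linarith

/-- Lower binomial tail. -/
noncomputable def hamzaH (n k : ℕ) (y : ℝ) : ℝ :=
  ∑ i ∈ Finset.range (k + 1), (n.choose i : ℝ) * y ^ i * (1 - y) ^ (n - i)

lemma hamzaH_deriv (n k : ℕ) (hk : k < n) (y : ℝ) :
    HasDerivAt (hamzaH n k)
      (-(((n - k : ℕ) : ℝ) * n.choose k * (y ^ k * (1 - y) ^ (n - 1 - k)))) y := by
  have hsub : HasDerivAt (fun y : ℝ => 1 - y) (-1) y := by
    simpa using (hasDerivAt_id y).const_sub 1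
  induction k with
  | zero =>
    have h := hsub.pow n
    have e : hamzaH n 0 = (fun y : ℝ => 1 - y) ^ n := by
      funext z; simp [hamzaH]
    rw [e]
    refine h.congr_deriv ?_
    simp
  | succ k ih =>
    have ih := ih (by omega)
    have h := ((hasDerivAt_pow (k + 1) y).const_mul (n.choose (k + 1) : ℝ)).mul
      (hsub.pow (n - (k + 1)))
    have e : hamzaH n (k + 1) = hamzaH n k + (fun y : ℝ => (n.choose (k + 1) : ℝ) * y ^ (k + 1))
        * (fun y : ℝ => 1 - y) ^ (n - (k + 1)) := by
      funext z
      simp [hamzaH, Finset.sum_range_succ _ (k + 1)]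
    rw [e]
    refine (ih.add h).congr_deriv ?_
    have hch : (n.choose (k + 1) : ℝ) * (k + 1) = n.choose k * ((n - k : ℕ) : ℝ) := by
      exact_mod_cast Nat.choose_succ_right_eq n k
    have i1 : n - 1 - k = n - (k + 1) := by omega
    have i2 : n - 1 - (k + 1) = n - (k + 1) - 1 := by omega
    rw [i1, i2]
    simp only [Pi.pow_apply, Nat.add_sub_cancel]
    push_cast
    linear_combination (y ^ k * (1 - y) ^ (n - (k + 1))) * hch

lemma hamzaH_anti (n k : ℕ) (hk : k < n) : AntitoneOn (hamzaH n k) (Set.Icc 0 1) := by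
  apply antitoneOn_of_deriv_nonpos (convex_Icc 0 1)
  · intro x _
    exact (hamzaH_deriv n k hk x).continuousAt.continuousWithinAt
  · intro x _
    exact (hamzaH_deriv n k hk x).differentiableAt.differentiableWithinAt
  · intro x hx
    rw [interior_Icc] at hx
    rw [(hamzaH_deriv n k hk x).deriv]
    have h1 : 0 ≤ 1 - x := by linarith [hx.2]
    have h2 : 0 ≤ x := hx.1.le
    apply neg_nonpos.mpr
    positivity

lemma hamzaH_zero (n k : ℕ) : hamzaH n k 0 = 1 := by
  unfold hamzaH
  rw [Finset.sum_eq_single 0]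
  · simp
  · intro i _ hi; simp [hi]
  · simp

lemma hamzaH_one (n k : ℕ) (hk : k < n) : hamzaH n k 1 = 0 := by
  unfold hamzaH
  apply Finset.sum_eq_zero
  intro i hi
  have : n - i ≠ 0 := by have := Finset.mem_range.mp hi; omega
  simp [this]

lemma hamzaH_ge (n k : ℕ) (hk : k < n) (q : ℝ) (hq0 : 0 ≤ q)
    (h : n * q + Real.log 2 < k + 1) : 1 / 2 ≤ hamzaH n k q := by
  have hc : 2 / 3 < Real.log 2 := by have := Real.log_two_gt_d9; norm_num at this ⊢; linarith
  have hc1 : Real.log 2 < 1 := by have := Real.log_two_lt_d9; norm_num at this ⊢; linarith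
  obtain ⟨a, rfl⟩ : ∃ a, n = a + k + 1 := ⟨n - 1 - k, by omega⟩
  have hn : (0:ℝ) < (a:ℝ) + k + 1 := by positivity
  let p : ℝ := (a + Real.log 2) / (a + k + 1)
  have hpe : p * (a + k + 1) = a + Real.log 2 := by simp only [p]; field_simp
  have hp : 0 < p := by positivity
  have hp1 : p < 1 := by
    simp only [p]; rw [div_lt_one hn]
    have : (0:ℝ) ≤ k := by positivity
    linarith
  have hqp : q ≤ 1 - p := by
    push_cast at h
    by_contra hh
    have := mul_lt_mul_of_pos_right (not_le.mp hh) hn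
    nlinarith
  have hmono := hamzaH_anti (a + k + 1) k hk ⟨hq0, by linarith⟩
    (⟨by linarith, by linarith⟩ : 1 - p ∈ Set.Icc (0:ℝ) 1) hqp
  have hcore := hamza_core a k (Real.log 2) p
    (((a + k + 1 - k : ℕ) : ℝ) * (a + k + 1).choose k) hc hc1
    (by rw [Real.exp_neg, Real.exp_log (by norm_num)]; norm_num) hp hp1
    (by
      have h1 : 0 < a + k + 1 - k := by omega
      have h2 : 0 < (a + k + 1).choose k := Nat.choose_pos (by omega)
      positivity) hpe (fun y => 1 - hamzaH (a + k + 1) k (1 - y))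
    (by
      intro y
      have hsub : HasDerivAt (fun y : ℝ => 1 - y) (-1) y := by
        simpa using (hasDerivAt_id y).const_sub 1
      have h2 : HasDerivAt (fun y : ℝ => hamzaH (a + k + 1) k (1 - y)) _ y :=
        (hamzaH_deriv (a + k + 1) k hk (1 - y)).comp y hsub
      refine (h2.const_sub 1).congr_deriv ?_
      have : a + k + 1 - 1 - k = a := by omega
      rw [this]
      ring)
    (by simp [hamzaH_one (a + k + 1) k hk]) (by simp [hamzaH_zero])
  linarith

/-- For `K ~ Bin(n,q)`, `P(K ≤ nq + ln 2) ≥ 1/2` (Hamza's mean-median bound). -/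
theorem binomial_le_mean_add_log_two
    {Ω : Type*} [MeasurableSpace Ω] (μ : Measure Ω) [IsProbabilityMeasure μ]
    (K : Ω → ℕ) (hK : Measurable K) (n : ℕ) (q : ℝ) (hq : q ∈ Set.Icc (0:ℝ) 1)
    (hbin : ∀ k : ℕ, μ (K ⁻¹' {k}) =
      ENNReal.ofReal ((n.choose k : ℝ) * q ^ k * (1 - q) ^ (n - k))) :
    μ {ω | (K ω : ℝ) ≤ n * q + Real.log 2} ≥ 1/2 := by
  obtain ⟨hq0, hq1⟩ := hq
  have hlog : 0 < Real.log 2 := Real.log_pos (by norm_num)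
  have hx : 0 ≤ n * q + Real.log 2 := by positivity
  set k := ⌊n * q + Real.log 2⌋₊ with hkdef
  have hset : {ω | (K ω : ℝ) ≤ n * q + Real.log 2} = K ⁻¹' (Finset.range (k + 1) : Finset ℕ) := by
    ext ω
    simp only [Set.mem_setOf_eq, Set.mem_preimage, Finset.coe_range, Set.mem_Iio, Nat.lt_succ_iff]
    exact (Nat.le_floor_iff hx).symm
  have hmeas : μ {ω | (K ω : ℝ) ≤ n * q + Real.log 2} = ENNReal.ofReal (hamzaH n k q) := by
    rw [hset, ← sum_measure_preimage_singleton _ (fun y _ => hK (measurableSet_singleton y))]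
    unfold hamzaH
    rw [ENNReal.ofReal_sum_of_nonneg]
    · exact Finset.sum_congr rfl fun i _ => hbin i
    · intro i _
      have : 0 ≤ 1 - q := by linarith
      positivity
  have hH : 1 / 2 ≤ hamzaH n k q := by
    rcases lt_or_ge k n with hkn | hkn
    · exact hamzaH_ge n k hkn q hq0 (Nat.lt_floor_add_one _)
    · have h1 : hamzaH n n q = 1 := by
        have := add_pow q (1 - q) n
        rw [add_sub_cancel, one_pow] at this
        rw [this, hamzaH]
        exact Finset.sum_congr rfl fun i _ => by ring
      have h2 : hamzaH n n q ≤ hamzaH n k q := by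
        unfold hamzaH
        apply Finset.sum_le_sum_of_subset_of_nonneg
        · intro i hi; simp only [Finset.mem_range] at hi ⊢; omega
        · intro i _ _
          have : 0 ≤ 1 - q := by linarith
          positivity
      linarith
  rw [hmeas, ge_iff_le]
  have : (1/2 : ENNReal) = ENNReal.ofReal (1/2) := by
    rw [ENNReal.ofReal_div_of_pos (by norm_num)]; simp
  rw [this]
  exact ENNReal.ofReal_le_ofReal hH
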